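/- arXiv:math/0303213 — 8 statements merged into one kernel-verified Lean document; each statement's English description precedes it below -/
import Mathlib

section
/- Let H be a finite-dimensional Hopf algebra over a field k with comultiplication Δ, and let Λ ∈ H be a two-sided integral, i.e. hΛ = ε(h)Λ = Λh for all h ∈ H. Then the element ν = m(Δ(Λ)) = ∑ Λ₁Λ₂ (where Δ(Λ) = ∑ Λ₁ ⊗ Λ₂ and m is multiplication) lies in the center of H. -/
open TensorProduct Coalgebra HopfAlgebra

section

variable {k H : Type*} [CommRing k] [Ring H] [HopfAlgebra k H]

/-- `∑ (S(h₁) ⊗ 1) Δ(h₂) = 1 ⊗ h`. -/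
theorem sum_antipode_tmul_one_mul_comul {ι : Type*} {h : H} (r : Repr k h ι) :
    ∑ i ∈ r.index, (antipode k (r.left i) ⊗ₜ[k] (1 : H)) * comul (R := k) (r.right i) =
      1 ⊗ₜ[k] h := by
  let F : H ⊗[k] (H ⊗[k] H) →ₗ[k] H ⊗[k] H :=
    (LinearMap.mul' k H ∘ₗ (antipode k).rTensor H).rTensor H ∘ₗ
      (TensorProduct.assoc k H H H).symm.toLinearMap
  have hF (x : H) (t : H ⊗[k] H) :
      F (x ⊗ₜ t) = (antipode k x ⊗ₜ[k] (1 : H)) * t := by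
    induction t with
    | zero => simp
    | add a b ha hb => rw [tmul_add, map_add, ha, hb, mul_add]
    | tmul a b => simp [F]
  calc _ = F (comul.lTensor H (comul (R := k) h)) := by
        rw [← r.eq]; simp [hF]
    _ = (LinearMap.mul' k H ∘ₗ (antipode k).rTensor H).rTensor H
          (comul.rTensor H (comul (R := k) h)) := by
        simp [F, ← Coalgebra.coassoc_apply]
    _ = 1 ⊗ₜ[k] h := by
        rw [← LinearMap.comp_apply, ← LinearMap.rTensor_comp, LinearMap.comp_assoc,
          mul_antipode_rTensor_comul, LinearMap.rTensor_comp, LinearMap.comp_apply,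
          rTensor_counit_comul]
        simp

/-- `∑ Δ(h₁) (1 ⊗ S(h₂)) = h ⊗ 1`. -/
theorem sum_comul_mul_one_tmul_antipode {ι : Type*} {h : H} (r : Repr k h ι) :
    ∑ i ∈ r.index, comul (R := k) (r.left i) * ((1 : H) ⊗ₜ[k] antipode k (r.right i)) =
      h ⊗ₜ[k] 1 := by
  let F : (H ⊗[k] H) ⊗[k] H →ₗ[k] H ⊗[k] H :=
    (LinearMap.mul' k H ∘ₗ (antipode k).lTensor H).lTensor H ∘ₗ
      (TensorProduct.assoc k H H H).toLinearMap
  have hF (x : H) (t : H ⊗[k] H) :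
      F (t ⊗ₜ x) = t * ((1 : H) ⊗ₜ[k] antipode k x) := by
    induction t with
    | zero => simp
    | add a b ha hb => rw [add_tmul, map_add, ha, hb, add_mul]
    | tmul a b => simp [F]
  calc _ = F (comul.rTensor H (comul (R := k) h)) := by
        rw [← r.eq]; simp [hF]
    _ = (LinearMap.mul' k H ∘ₗ (antipode k).lTensor H).lTensor H
          (comul.lTensor H (comul (R := k) h)) := by
        simp [F, ← Coalgebra.coassoc_apply]
    _ = h ⊗ₜ[k] 1 := by
        rw [← LinearMap.comp_apply, ← LinearMap.lTensor_comp, LinearMap.comp_assoc,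
          mul_antipode_lTensor_comul, LinearMap.lTensor_comp, LinearMap.comp_apply,
          lTensor_counit_comul]
        simp

/-- `∑ (h₁ ⊗ S(h₂)) (1 ⊗ h₃) = h ⊗ 1`. -/
theorem sum_lTensor_antipode_comul_mul_one_tmul {ι : Type*} {h : H} (r : Repr k h ι) :
    ∑ i ∈ r.index, (antipode k).lTensor H (comul (R := k) (r.left i)) *
      ((1 : H) ⊗ₜ[k] r.right i) = h ⊗ₜ[k] 1 := by
  let F : (H ⊗[k] H) ⊗[k] H →ₗ[k] H ⊗[k] H :=
    (LinearMap.mul' k H ∘ₗ (antipode k).rTensor H).lTensor H ∘ₗ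
      (TensorProduct.assoc k H H H).toLinearMap
  have hF (x : H) (t : H ⊗[k] H) :
      F (t ⊗ₜ x) = (antipode k).lTensor H t * ((1 : H) ⊗ₜ[k] x) := by
    induction t with
    | zero => simp
    | add a b ha hb => rw [add_tmul, map_add, ha, hb, map_add, add_mul]
    | tmul a b => simp [F]
  calc _ = F (comul.rTensor H (comul (R := k) h)) := by
        rw [← r.eq]; simp [hF]
    _ = (LinearMap.mul' k H ∘ₗ (antipode k).rTensor H).lTensor H
          (comul.lTensor H (comul (R := k) h)) := by
        simp [F, ← Coalgebra.coassoc_apply]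
    _ = h ⊗ₜ[k] 1 := by
        rw [← LinearMap.comp_apply, ← LinearMap.lTensor_comp, LinearMap.comp_assoc,
          mul_antipode_rTensor_comul, LinearMap.lTensor_comp, LinearMap.comp_apply,
          lTensor_counit_comul]
        simp

/-- For a left integral, `∑ Λ₁ ⊗ h Λ₂ = ∑ S(h) Λ₁ ⊗ Λ₂`. -/
theorem one_tmul_mul_comul_of_left_integral {Λ : H}
    (hΛ : ∀ h : H, h * Λ = counit (R := k) h • Λ) (h : H) :
    ((1 : H) ⊗ₜ[k] h) * comul (R := k) Λ = (antipode k h ⊗ₜ[k] (1 : H)) * comul (R := k) Λ := by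
  have key (x : H) : comul (R := k) x * comul (R := k) Λ = counit (R := k) x • comul Λ := by
    rw [← Bialgebra.comul_mul, hΛ, map_smul]
  rw [← sum_antipode_tmul_one_mul_comul (ℛ k h), Finset.sum_mul]
  simp_rw [mul_assoc, key, mul_smul_comm, ← smul_mul_assoc]
  rw [← Finset.sum_mul]
  simp_rw [smul_tmul', ← map_smul, ← sum_tmul, ← map_sum]
  have hsum : ∑ i ∈ (ℛ k h).index, counit (R := k) ((ℛ k h).right i) • (ℛ k h).left i = h := by
    simpa only [map_sum, rid_tmul, one_smul] using
      congrArg (TensorProduct.rid k H) (sum_tmul_counit_eq (ℛ k h))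
  rw [hsum]

/-- For a right integral, `∑ Λ₁ h ⊗ Λ₂ = ∑ Λ₁ ⊗ Λ₂ S(h)`. -/
theorem comul_mul_tmul_one_of_right_integral {Λ : H}
    (hΛ : ∀ h : H, Λ * h = counit (R := k) h • Λ) (h : H) :
    comul (R := k) Λ * (h ⊗ₜ[k] (1 : H)) = comul (R := k) Λ * ((1 : H) ⊗ₜ[k] antipode k h) := by
  have key (x : H) : comul (R := k) Λ * comul (R := k) x = counit (R := k) x • comul Λ := by
    rw [← Bialgebra.comul_mul, hΛ, map_smul]
  rw [← sum_comul_mul_one_tmul_antipode (ℛ k h), Finset.mul_sum]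
  simp_rw [← mul_assoc, key, smul_mul_assoc, ← mul_smul_comm]
  rw [← Finset.mul_sum]
  simp_rw [← tmul_smul, ← map_smul, ← tmul_sum, ← map_sum]
  rw [sum_counit_smul]

/-- If `Λ` is a two-sided integral, `∑ Λ₁ Λ₂` commutes with the image of the antipode. -/
theorem antipode_mul_mul_comul_of_integral {Λ : H}
    (hl : ∀ h : H, h * Λ = counit (R := k) h • Λ)
    (hr : ∀ h : H, Λ * h = counit (R := k) h • Λ) (g : H) :
    antipode k g * LinearMap.mul' k H (comul (R := k) Λ) =
      LinearMap.mul' k H (comul (R := k) Λ) * antipode k g := by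
  have h₁ (t : H ⊗[k] H) : LinearMap.mul' k H ((antipode k g ⊗ₜ[k] (1 : H)) * t) =
      antipode k g * LinearMap.mul' k H t := by
    induction t with
    | zero => simp
    | add a b ha hb => simp only [mul_add, map_add, ha, hb]
    | tmul a b => simp [mul_assoc]
  have h₂ (t : H ⊗[k] H) : LinearMap.mul' k H (t * ((1 : H) ⊗ₜ[k] antipode k g)) =
      LinearMap.mul' k H t * antipode k g := by
    induction t with
    | zero => simp
    | add a b ha hb => simp only [add_mul, map_add, ha, hb]
    | tmul a b => simp [mul_assoc]
  have h₃ (t : H ⊗[k] H) : LinearMap.mul' k H (((1 : H) ⊗ₜ[k] g) * t) =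
      LinearMap.mul' k H (t * (g ⊗ₜ[k] (1 : H))) := by
    induction t with
    | zero => simp
    | add a b ha hb => simp only [add_mul, mul_add, map_add, ha, hb]
    | tmul a b => simp [mul_assoc]
  rw [← h₁, ← one_tmul_mul_comul_of_left_integral hl, h₃,
    comul_mul_tmul_one_of_right_integral hr, h₂]

end

/-- A Hopf algebra over a field with a nonzero left integral has injective antipode. -/
theorem antipode_injective_of_left_integral {k H : Type*} [Field k] [Ring H] [HopfAlgebra k H]
    {Λ : H} (hΛ : ∀ h : H, h * Λ = counit (R := k) h • Λ) (hne : Λ ≠ 0) :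
    Function.Injective (antipode k : H →ₗ[k] H) := by
  rw [← LinearMap.ker_eq_bot, LinearMap.ker_eq_bot']
  intro h hh
  let e := Module.Basis.ofVectorSpace k H
  obtain ⟨b, hb⟩ := TensorProduct.eq_repr_basis_left e (comul (R := k) Λ)
  let r : Repr k Λ _ := ⟨b.support, e, b, hb⟩
  have vanish (x : H) : ((1 : H) ⊗ₜ[k] (h * x)) * comul (R := k) Λ = 0 := by
    calc _ = ((1 : H) ⊗ₜ[k] h) * (((1 : H) ⊗ₜ[k] x) * comul (R := k) Λ) := by
          simp [← mul_assoc]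
      _ = (antipode k x ⊗ₜ[k] (1 : H)) * (((1 : H) ⊗ₜ[k] h) * comul (R := k) Λ) := by
          rw [one_tmul_mul_comul_of_left_integral hΛ]; simp [← mul_assoc]
      _ = 0 := by rw [one_tmul_mul_comul_of_left_integral hΛ, hh]; simp
  have annihilate (x : H) (i) : h * x * b i = 0 := by
    have h₀ := vanish x
    rw [← hb, Finsupp.sum, Finset.mul_sum] at h₀
    simp only [Algebra.TensorProduct.tmul_mul_tmul, one_mul] at h₀
    have hmap := TensorProduct.sum_tmul_basis_left_eq_zero e
      (b.mapRange (fun y => h * x * y) (mul_zero _))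
      ((Finsupp.sum_mapRange_index (by simp)).trans h₀)
    simpa using DFunLike.congr_fun hmap i
  have hzero : Λ ⊗ₜ[k] h = 0 := by
    have h₀ := congrArg (((1 : H) ⊗ₜ[k] h) * ·) (sum_lTensor_antipode_comul_mul_one_tmul r)
    simp only [Algebra.TensorProduct.tmul_mul_tmul, one_mul, mul_one] at h₀
    rw [← h₀, Finset.mul_sum]
    refine Finset.sum_eq_zero fun i _ => ?_
    generalize comul (R := k) (r.left i) = t
    induction t with
    | zero => simp
    | add a b ha hb => simp only [map_add, add_mul, mul_add, ha, hb, add_zero]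
    | tmul y x =>
      have := annihilate (antipode k x) i
      simp [← mul_assoc, r, this]
  by_contra hh₀
  refine hne ((Module.forall_dual_apply_eq_zero_iff k Λ).mp fun f => ?_)
  have hf := congrArg (TensorProduct.lid k H ∘ f.rTensor H) hzero
  simpa [hh₀] using hf

/-- Let `H` be a finite-dimensional Hopf algebra over a field `k` with
comultiplication `Δ`, and let `Λ ∈ H` be a two-sided integral, i.e.
`h * Λ = ε(h) • Λ = Λ * h` for all `h ∈ H`. Then the element `ν = m(Δ(Λ))` (where `m` is
the multiplication map `H ⊗ H → H`) lies in the center of `H`. -/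
theorem mul_comul_two_sided_integral_mem_center
    (k : Type*) [Field k] (H : Type*) [Ring H] [HopfAlgebra k H]
    [FiniteDimensional k H]
    (Λ : H) (hΛleft : ∀ h : H, h * Λ = Coalgebra.counit (R := k) h • Λ)
    (hΛright : ∀ h : H, Λ * h = Coalgebra.counit (R := k) h • Λ) :
    LinearMap.mul' k H (Coalgebra.comul (R := k) Λ) ∈ Set.center H := by
  rcases eq_or_ne Λ 0 with rfl | hne
  · simp
  rw [Semigroup.mem_center_iff]
  intro h
  obtain ⟨g, rfl⟩ := LinearMap.injective_iff_surjective.mp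
    (antipode_injective_of_left_integral hΛleft hne) h
  exact antipode_mul_mul_comul_of_integral hΛleft hΛright g
end

section
/- Let A be a finite-dimensional split semisimple algebra over a field k (i.e. A is isomorphic as a k-algebra to a finite direct product of full matrix algebras over k), and let S be an algebra anti-automorphism of A such that S² is inner, i.e. there exists a unit v ∈ A with S²(x) = v x v⁻¹ for all x ∈ A. Then there exists a unit u ∈ A such that the map S_u defined by S_u(x) = u S(x) u⁻¹ satisfies S_u² = id_A. -/
/-- `S` is a linear anti-endomorphism whose square is an inner automorphism. -/
structure IsAntiHomWithInnerSquare {k A : Type*} [CommSemiring k] [Ring A] [Algebra k A]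
    (S : A →ₗ[k] A) : Prop where
  map_one : S 1 = 1
  map_mul : ∀ x y, S (x * y) = S y * S x
  sq_inner : ∃ v : Aˣ, ∀ x, S (S x) = v * x * ↑v⁻¹

/-- Some conjugate `x ↦ u * S x * u⁻¹` of `S` is an involution. -/
def HasInvolutiveConjugate {k A : Type*} [CommSemiring k] [Ring A] [Algebra k A]
    (S : A →ₗ[k] A) : Prop :=
  ∃ u : Aˣ, ∀ x, u * S (u * S x * ↑u⁻¹) * ↑u⁻¹ = x

theorem IsSimpleRing.eq_zero_or_one_of_mem_center {A : Type*} [Ring A] [IsSimpleRing A]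
    {e : A} (he : e ∈ Subring.center A) (hee : e * e = e) : e = 0 ∨ e = 1 := by
  have := (IsSimpleRing.isField_center A).isDomain
  have h : IsIdempotentElem (⟨e, he⟩ : Subring.center A) := Subtype.ext hee
  simpa [Subtype.ext_iff] using IsIdempotentElem.iff_eq_zero_or_one.1 h

namespace IsAntiHomWithInnerSquare

section General

variable {k A B : Type*} [CommSemiring k] [Ring A] [Algebra k A] [Ring B] [Algebra k B]
  {S : A →ₗ[k] A}

theorem bijective (hS : IsAntiHomWithInnerSquare S) : Function.Bijective S := by
  obtain ⟨v, hv⟩ := hS.sq_inner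
  refine ⟨fun x y hxy ↦ ?_, fun y ↦ ⟨S (↑v⁻¹ * y * v), by simp [hv, mul_assoc]⟩⟩
  simpa [hv] using congrArg S hxy

theorem map_mem_center (hS : IsAntiHomWithInnerSquare S) {z : A} (hz : z ∈ Subring.center A) :
    S z ∈ Subring.center A := by
  rw [Subring.mem_center_iff] at hz ⊢
  intro y
  obtain ⟨x, rfl⟩ := hS.bijective.2 y
  rw [← hS.map_mul, ← hS.map_mul, hz]

theorem map_map_of_mem_center (hS : IsAntiHomWithInnerSquare S) {z : A}
    (hz : z ∈ Subring.center A) : S (S z) = z := by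
  obtain ⟨v, hv⟩ := hS.sq_inner
  rw [hv, Subring.mem_center_iff.1 hz, mul_assoc, Units.mul_inv, mul_one]

/-- If `S²` is conjugation by `v`, then `S v * v` is central, because `S` commutes with `S²`. -/
theorem map_mul_self_conj (hS : IsAntiHomWithInnerSquare S) {v : Aˣ}
    (hv : ∀ x, S (S x) = v * x * ↑v⁻¹) (x : A) :
    S v * (v * x * ↑v⁻¹) * S ↑v⁻¹ = x := by
  obtain ⟨y, rfl⟩ := hS.bijective.2 x
  rw [← hv, ← hS.map_mul, ← hS.map_mul, hv y]
  congr 1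
  simp [mul_assoc]

theorem conj (hS : IsAntiHomWithInnerSquare S) (f : A ≃ₐ[k] B) :
    IsAntiHomWithInnerSquare (f.toLinearMap ∘ₗ S ∘ₗ f.symm.toLinearMap) where
  map_one := by simp [hS.map_one]
  map_mul x y := by simp [hS.map_mul]
  sq_inner := by
    obtain ⟨v, hv⟩ := hS.sq_inner
    exact ⟨Units.map (f : A →* B) v, fun x ↦ by simp [hv]⟩

end General

/-- An anti-endomorphism with inner square of a full matrix algebra is conjugate to the
transpose. -/
theorem hasInvolutiveConjugate_matrix {k n : Type*} [Field k] [Fintype n] [DecidableEq n]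
    {S : Matrix n n k →ₗ[k] Matrix n n k} (hS : IsAntiHomWithInnerSquare S) :
    HasInvolutiveConjugate S := by
  let φ : Matrix n n k →ₐ[k] Matrix n n k :=
    AlgHom.ofLinearMap (S ∘ₗ (Matrix.transposeLinearEquiv n n k k).toLinearMap)
      (by simp [hS.map_one]) (by simp [hS.map_mul])
  have hφ : Function.Bijective φ :=
    hS.bijective.comp (Matrix.transposeLinearEquiv n n k k).bijective
  let e : Matrix n n k ≃ₐ[k] Module.End k (n → k) := Matrix.toLinAlgEquiv'
  obtain ⟨T, hT⟩ := ((e.symm.trans (AlgEquiv.ofBijective φ hφ)).trans e).eq_linearEquivConjAlgEquiv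
  let g : (Matrix n n k)ˣ :=
    Units.map (e.symm : Module.End k (n → k) →* Matrix n n k)
      (LinearMap.GeneralLinearGroup.ofLinearEquiv T)
  have hg (x : Matrix n n k) : S x = (g : Matrix n n k) * x.transpose * (↑g⁻¹ : Matrix n n k) := by
    have h := congrArg e.symm (DFunLike.congr_fun hT (e x.transpose))
    have h' : S x = e.symm (T.conjAlgEquiv k (e x.transpose)) := by simpa [φ] using h
    have hconj : T.conjAlgEquiv k (e x.transpose) =
        (LinearMap.GeneralLinearGroup.ofLinearEquiv T : Module.End k (n → k)) * e x.transpose *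
          (↑(LinearMap.GeneralLinearGroup.ofLinearEquiv T)⁻¹ : Module.End k (n → k)) := rfl
    rw [h', hconj, _root_.map_mul, _root_.map_mul, e.symm_apply_apply]
    rfl
  refine ⟨g⁻¹, fun x ↦ ?_⟩
  simp [hg, mul_assoc]

section Pi

variable {k ι : Type*} [CommSemiring k] [DecidableEq ι] {R : ι → Type*}
  [∀ i, Ring (R i)] [∀ i, Algebra k (R i)] {S : (∀ i, R i) →ₗ[k] ∀ i, R i}

theorem single_one_mem_center (i : ι) :
    (Pi.single i 1 : ∀ i, R i) ∈ Subring.center (∀ i, R i) := by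
  rw [Subring.mem_center_iff]
  intro g
  ext j
  obtain rfl | h := eq_or_ne j i <;> simp [*]

theorem map_apply_congr {i j : ι} (hS : IsAntiHomWithInnerSquare S)
    (hij : S (Pi.single i 1) = Pi.single j 1) {x y : ∀ i, R i} (h : x i = y i) :
    S x j = S y j := by
  have key (x : ∀ i, R i) : S x j = S (Pi.single i (x i)) j := by
    have h1 : Pi.single i (x i) = Pi.single i 1 * x := by
      rw [← Pi.single_mul_left, one_mul]
    rw [h1, hS.map_mul, hij]
    simp
  rw [key x, key y, h]

/-- `S` permutes the central idempotents of the factors, by an involution. -/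
theorem exists_map_single_one [∀ i, IsSimpleRing (R i)] (hS : IsAntiHomWithInnerSquare S)
    (i : ι) : ∃ j, S (Pi.single i 1) = Pi.single j 1 ∧ S (Pi.single j 1) = Pi.single i 1 := by
  have hidem (i : ι) : S (Pi.single i 1) * S (Pi.single i 1) = S (Pi.single i 1) := by
    rw [← hS.map_mul, ← Pi.single_mul, one_mul]
  have hcomp (i j : ι) : S (Pi.single i 1) j = 0 ∨ S (Pi.single i 1) j = 1 := by
    refine IsSimpleRing.eq_zero_or_one_of_mem_center ?_ (congrFun (hidem i) j)
    have h := hS.map_mem_center (single_one_mem_center (R := R) i)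
    rw [Subring.mem_center_iff] at h ⊢
    intro g
    simpa using congrFun (h (Pi.single j g)) j
  have hne (i : ι) : S (Pi.single i 1) ≠ 0 := fun h ↦ by
    have := hS.bijective.1 (h.trans (map_zero S).symm)
    simp at this
  obtain ⟨j, hj⟩ := Function.ne_iff.1 (hne i)
  have hj1 : S (Pi.single i 1) j = 1 := (hcomp i j).resolve_left hj
  have hmul : Pi.single j 1 * S (Pi.single i 1) = Pi.single j 1 := by
    rw [← Pi.single_mul_left, hj1, one_mul]
  have hmul' : Pi.single i 1 * S (Pi.single j 1) = S (Pi.single j 1) := by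
    simpa [hS.map_mul, hS.map_map_of_mem_center (single_one_mem_center (R := R) i)]
      using congrArg S hmul
  have hji : S (Pi.single j 1) = Pi.single i 1 := by
    rw [← Pi.single_mul_left, one_mul] at hmul'
    rcases hcomp j i with h | h
    · rw [h, Pi.single_zero] at hmul'
      exact absurd hmul'.symm (hne j)
    · rw [← hmul', h]
  exact ⟨j, by rw [← hji, hS.map_map_of_mem_center (single_one_mem_center (R := R) j)], hji⟩

end Pi

/-- The restriction of `S` to a factor whose central idempotent it fixes. -/
theorem restrict {k ι : Type*} [CommSemiring k] [DecidableEq ι] {R : ι → Type*}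
    [∀ i, Ring (R i)] [∀ i, Algebra k (R i)] {S : (∀ i, R i) →ₗ[k] ∀ i, R i}
    (hS : IsAntiHomWithInnerSquare S) {i : ι} (hi : S (Pi.single i 1) = Pi.single i 1) :
    IsAntiHomWithInnerSquare (LinearMap.proj i ∘ₗ S ∘ₗ LinearMap.single k R i) where
  map_one := by simp [hi]
  map_mul x y := by simp [Pi.single_mul, hS.map_mul]
  sq_inner := by
    obtain ⟨v, hv⟩ := hS.sq_inner
    refine ⟨Units.map (Pi.evalMonoidHom R i) v, fun x ↦ ?_⟩
    have h : S (Pi.single i (S (Pi.single i x) i)) i = S (S (Pi.single i x)) i :=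
      hS.map_apply_congr hi (by simp)
    simp [h, hv]

theorem hasInvolutiveConjugate_pi {k ι : Type*} [CommSemiring k] [LinearOrder ι] {R : ι → Type*}
    [∀ i, Ring (R i)] [∀ i, Algebra k (R i)] [∀ i, IsSimpleRing (R i)]
    (hR : ∀ i (T : R i →ₗ[k] R i), IsAntiHomWithInnerSquare T → HasInvolutiveConjugate T)
    {S : (∀ i, R i) →ₗ[k] ∀ i, R i} (hS : IsAntiHomWithInnerSquare S) :
    HasInvolutiveConjugate S := by
  obtain ⟨v, hv⟩ := hS.sq_inner
  choose σ hσ hσ' using hS.exists_map_single_one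
  have hfix (i : ι) : ∃ w : (R i)ˣ, σ i = i → ∀ x : R i,
      w * S (Pi.single i (w * S (Pi.single i x) i * ↑w⁻¹)) i * ↑w⁻¹ = x := by
    by_cases hi : σ i = i
    · obtain ⟨w, hw⟩ := hR i _ (hS.restrict (i := i) (by rw [hσ, hi]))
      exact ⟨w, fun _ ↦ hw⟩
    · exact ⟨1, fun h ↦ absurd h hi⟩
  choose w hw using hfix
  have hσσ (i : ι) : σ (σ i) = i := by
    by_contra h
    have := congrFun ((hσ (σ i)).symm.trans (hσ' i)) i
    simp [Pi.single_eq_of_ne (Ne.symm h)] at this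
  -- One member of each exchanged pair of factors carries `v⁻¹`, the other one carries `1`.
  let u₀ (i : ι) : (R i)ˣ :=
    if σ i = i then w i else if i < σ i then Units.map (Pi.evalMonoidHom R i) v⁻¹ else 1
  let u : (∀ i, R i)ˣ := MulEquiv.piUnits.symm u₀
  have hu (i : ι) : (u : ∀ i, R i) i = u₀ i := rfl
  have hu' (i : ι) : (↑u⁻¹ : ∀ i, R i) i = ↑(u₀ i)⁻¹ := rfl
  refine ⟨u, fun x ↦ funext fun j ↦ ?_⟩
  rcases lt_trichotomy j (σ j) with hj | hj | hj
  · have h₀ : u₀ j = Units.map (Pi.evalMonoidHom R j) v⁻¹ := by simp [u₀, hj, hj.ne']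
    have h₁ : u₀ (σ j) = 1 := by simp [u₀, hσσ, hj.ne, hj.le]
    have h₂ : S (u * S x * ↑u⁻¹) j = S (S x) j :=
      hS.map_apply_congr (hσ' j) (by simp [hu, hu', h₁])
    simp only [Pi.mul_apply, h₂, hu, hu', h₀, hv]
    have h₃ : (↑v⁻¹ * (v * x * ↑v⁻¹) * v : ∀ i, R i) = x := by simp [mul_assoc]
    exact congrFun h₃ j
  · have h₀ : u₀ j = w j := by simp [u₀, ← hj]
    have hjj : S (Pi.single j 1) = Pi.single j 1 := by rw [hσ, ← hj]
    have h₂ : S (u * S x * ↑u⁻¹) j =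
        S (Pi.single j (w j * S (Pi.single j (x j)) j * ↑(w j)⁻¹)) j :=
      hS.map_apply_congr hjj (by
        simp [hu, hu', h₀, hS.map_apply_congr hjj (x := x) (y := Pi.single j (x j)) (by simp)])
    simp only [Pi.mul_apply, h₂, hu, hu', h₀]
    exact hw j hj.symm (x j)
  · have h₀ : u₀ j = 1 := by simp [u₀, hj.ne, hj.le]
    have h₁ : u₀ (σ j) = Units.map (Pi.evalMonoidHom R (σ j)) v⁻¹ := by
      simp [u₀, hσσ, hj, hj.ne']
    have h₂ : S (u * S x * ↑u⁻¹) j = S (↑v⁻¹ * S x * v) j :=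
      hS.map_apply_congr (hσ' j) (by simp [hu, hu', h₁])
    have h₃ := hS.map_mul_self_conj hv x
    simp only [Pi.mul_apply, h₂, hu, hu', h₀, Units.val_one, inv_one, one_mul, mul_one]
    rw [hS.map_mul, hS.map_mul, hv, ← mul_assoc, h₃]

theorem hasInvolutiveConjugate_of_algEquiv {k A B : Type*} [CommSemiring k] [Ring A] [Algebra k A]
    [Ring B] [Algebra k B] (f : A ≃ₐ[k] B)
    (hB : ∀ T : B →ₗ[k] B, IsAntiHomWithInnerSquare T → HasInvolutiveConjugate T)
    {S : A →ₗ[k] A} (hS : IsAntiHomWithInnerSquare S) : HasInvolutiveConjugate S := by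
  obtain ⟨u, hu⟩ := hB _ (hS.conj f)
  refine ⟨Units.map (f.symm : B →* A) u, fun x ↦ f.injective ?_⟩
  simpa using hu (f x)

end IsAntiHomWithInnerSquare

/-- Empty matrix blocks can be dropped from a product of matrix algebras. -/
theorem bijective_restrict_nonempty_blocks {ι k : Type*} (n : ι → ℕ) :
    Function.Bijective
      (fun (x : ∀ i, Matrix (Fin (n i)) (Fin (n i)) k) (i : {i // n i ≠ 0}) ↦ x i) := by
  refine ⟨fun x y h ↦ ?_, fun y ↦ ?_⟩
  · ext i a b
    exact congrFun (congrFun (congrFun h ⟨i, fun h0 ↦ (h0 ▸ a).elim0⟩) a) b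
  · exact ⟨fun i ↦ Matrix.of fun a ↦ y ⟨i, fun h0 ↦ (h0 ▸ a).elim0⟩ a, rfl⟩


/-- Let `A` be a finite-dimensional split semisimple algebra over a field `k`
(i.e. `A` is isomorphic as a `k`-algebra to a finite direct product of full matrix algebras
over `k`), and let `S` be an algebra anti-automorphism of `A` such that `S²` is inner, i.e.
there is a unit `v` with `S²(x) = v x v⁻¹` for all `x`. Then there exists a unit `u ∈ A` such
that `S_u : x ↦ u S(x) u⁻¹` satisfies `S_u² = id`. -/
theorem exists_unit_conjugate_antipode_involutive
    (k : Type*) [Field k] (A : Type*) [Ring A] [Algebra k A] [FiniteDimensional k A]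
    (hsplit : ∃ (d : ℕ) (n : Fin d → ℕ)
      (_ : A ≃ₐ[k] ∀ i : Fin d, Matrix (Fin (n i)) (Fin (n i)) k), True)
    (S : A →ₗ[k] A) (hSbij : Function.Bijective S)
    (hS1 : S 1 = 1) (hSmul : ∀ x y : A, S (x * y) = S y * S x)
    (hinner : ∃ v vinv : A, v * vinv = 1 ∧ vinv * v = 1 ∧
      ∀ x : A, S (S x) = v * x * vinv) :
    ∃ u uinv : A, u * uinv = 1 ∧ uinv * u = 1 ∧
      ∀ x : A, u * S (u * S x * uinv) * uinv = x := by
  obtain ⟨d, n, f, -⟩ := hsplit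
  obtain ⟨v, vinv, hv, hv', hSS⟩ := hinner
  have hS : IsAntiHomWithInnerSquare S := ⟨hS1, hSmul, ⟨v, vinv, hv, hv'⟩, hSS⟩
  let r : (∀ i, Matrix (Fin (n i)) (Fin (n i)) k) →ₐ[k]
      ∀ i : {i // n i ≠ 0}, Matrix (Fin (n i)) (Fin (n i)) k :=
    AlgHom.pi fun i ↦ Pi.evalAlgHom k _ i.1
  let e := f.trans (AlgEquiv.ofBijective r (bijective_restrict_nonempty_blocks n))
  have (i : {i // n i ≠ 0}) : NeZero (n i) := ⟨i.2⟩
  obtain ⟨u, hu⟩ := hS.hasInvolutiveConjugate_of_algEquiv e fun T hT ↦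
    hT.hasInvolutiveConjugate_pi
      (R := fun i : {i // n i ≠ 0} ↦ Matrix (Fin (n i)) (Fin (n i)) k)
      fun i T hT ↦ hT.hasInvolutiveConjugate_matrix
  exact ⟨u, ↑u⁻¹, u.mul_inv, u.inv_mul, hu⟩
end

section
/- Let G be a finite group, k a field, and ω : G × G × G → k× a normalized 3-cocycle. Define θ_g(x,y) = ω(g,x,y)·ω(x,y,(xy)⁻¹g(xy)) / ω(x, x⁻¹gx, y). Then for all a, b, c, z ∈ G: θ_z(a,b)·θ_z(ab,c) = θ_{a⁻¹za}(b,c)·θ_z(a,bc). -/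
/-- The 2-cochain `θ_g(x,y) = ω(g,x,y)·ω(x,y,(xy)⁻¹g(xy)) / ω(x, x⁻¹gx, y)`
associated to a 3-cocycle `ω` on `G` with values in `kˣ`. -/
def theta {G : Type*} [Group G] {k : Type*} [Field k]
    (ω : G → G → G → kˣ) (g x y : G) : kˣ :=
  ω g x y * ω x y ((x * y)⁻¹ * g * (x * y)) / ω x (x⁻¹ * g * x) y

/-- The 2-cochain `γ_g(x,y) = ω(x,y,g)·ω(g, g⁻¹xg, g⁻¹yg) / ω(x, g, g⁻¹yg)`
associated to a 3-cocycle `ω` on `G` with values in `kˣ`. -/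
def gammaCochain {G : Type*} [Group G] {k : Type*} [Field k]
    (ω : G → G → G → kˣ) (g x y : G) : kˣ :=
  ω x y g * ω g (g⁻¹ * x * g) (g⁻¹ * y * g) / ω x g (g⁻¹ * y * g)

/-- Identity (25) of the paper:
`θ_z(a,b)·θ_z(ab,c) = θ_{a⁻¹za}(b,c)·θ_z(a,bc)`. -/
theorem theta_cocycle_identity
    (G : Type*) [Group G] [Finite G] (k : Type*) [Field k]
    (ω : G → G → G → kˣ)
    (hnorm : ∀ x y z : G, x = 1 ∨ y = 1 ∨ z = 1 → ω x y z = 1)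
    (hcoc : ∀ g x y z : G,
      ω g x y * ω g (x * y) z * ω x y z = ω (g * x) y z * ω g x (y * z))
    (a b c z : G) :
    theta ω z a b * theta ω z (a * b) c
      = theta ω (a⁻¹ * z * a) b c * theta ω z a (b * c) := by
  -- With `u, v, w` the conjugates of `z` by `a, ab, abc`, combine the cocycle relations at
  -- `(z,a,b,c)`, `(a,u,b,c)`, `(a,b,v,c)` and `(a,b,c,w)`.
  obtain ⟨u, hu⟩ : ∃ u, u = a⁻¹ * z * a := ⟨_, rfl⟩
  obtain ⟨v, hv⟩ : ∃ v, v = b⁻¹ * u * b := ⟨_, rfl⟩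
  obtain ⟨w, hw⟩ : ∃ w, w = c⁻¹ * v * c := ⟨_, rfl⟩
  have hza : z * a = a * u := by rw [hu]; group
  have hub : u * b = b * v := by rw [hv]; group
  have hvc : v * c = c * w := by rw [hw]; group
  have hv_ab : (a * b)⁻¹ * z * (a * b) = v := by rw [hv, hu]; group
  have hw_abc : (a * b * c)⁻¹ * z * (a * b * c) = w := by rw [hw, hv, hu]; group
  have hw_bc : (b * c)⁻¹ * u * (b * c) = w := by rw [hw, hv]; group
  have h_zabc := hcoc z a b c
  have h_aubc := hcoc a u b c
  have h_abvc := hcoc a b v c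
  have h_abcw := hcoc a b c w
  rw [hza] at h_zabc
  rw [hub] at h_aubc
  rw [hvc] at h_abvc
  simp only [theta, ← mul_assoc a b c, hv_ab, hw_abc, ← hu, ← hv, hw_bc]
  rw [div_mul_div_comm, div_mul_div_comm, div_eq_div_iff_mul_eq_mul]
  apply mul_right_cancel
    (b := ω a b c * ω (a * u) b c * ω a (b * v) c * ω a b (c * w))
  have h := congrArg₂ (· * ·) (congrArg₂ (· * ·) h_zabc h_abvc)
    (congrArg₂ (· * ·) h_aubc.symm h_abcw.symm)
  calc _ = _ := by ac_rfl
    _ = _ := h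
    _ = _ := by ac_rfl
end

section
/- Let G be a finite group, k a field, and ω : G × G × G → k× a normalized 3-cocycle. Define θ_g(x,y) = ω(g,x,y)·ω(x,y,(xy)⁻¹g(xy)) / ω(x, x⁻¹gx, y) and γ_g(x,y) = ω(x,y,g)·ω(g, g⁻¹xg, g⁻¹yg) / ω(x, g, g⁻¹yg). Then for all a, b, y, z ∈ G: θ_y(a,b)·θ_z(a,b)·γ_a(y,z)·γ_b(a⁻¹ya, a⁻¹za) = θ_{yz}(a,b)·γ_{ab}(y,z). -/
/-- The shuffle identity for an additive 3-cocycle `f`: the alternating sum of the cocycle condition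
over the six shuffles of `(y, z)` with `(a, b)`, where `y₁`, `y₂` (resp. `z₁`, `z₂`) are the
conjugates of `y` (resp. `z`) obtained by moving it past `a` and then past `b`. -/
theorem cocycle_shuffle {G A : Type*} [Semigroup G] [AddCommGroup A] (f : G → G → G → A)
    (hf : ∀ g x y z : G,
      f g x y + f g (x * y) z + f x y z = f (g * x) y z + f g x (y * z))
    {a b y y₁ y₂ z z₁ z₂ : G} (hy₁ : a * y₁ = y * a) (hy₂ : b * y₂ = y₁ * b)
    (hz₁ : a * z₁ = z * a) (hz₂ : b * z₂ = z₁ * b) :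
    (f y a b + f a b y₂ - f a y₁ b) + (f z a b + f a b z₂ - f a z₁ b) +
        (f y z a + f a y₁ z₁ - f y a z₁) + (f y₁ z₁ b + f b y₂ z₂ - f y₁ b z₂)
      = (f (y * z) a b + f a b (y₂ * z₂) - f a (y₁ * z₁) b) +
        (f y z (a * b) + f (a * b) y₂ z₂ - f y (a * b) z₂) := by
  have yzab := hf y z a b
  have yazb := hf y a z₁ b
  have yabz := hf y a b z₂
  have ayzb := hf a y₁ z₁ b
  have aybz := hf a y₁ b z₂
  have abyz := hf a b y₂ z₂
  rw [hz₁] at yazb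
  rw [hz₂] at yabz aybz
  rw [hy₁] at ayzb aybz
  rw [hy₂] at abyz
  linear_combination (norm := abel) yzab - yazb + yabz + ayzb - aybz + abyz

/-- Identity (26) of the paper:
`θ_y(a,b)·θ_z(a,b)·γ_a(y,z)·γ_b(a⁻¹ya, a⁻¹za) = θ_{yz}(a,b)·γ_{ab}(y,z)`. -/
theorem theta_gamma_compatibility
    (G : Type*) [Group G] [Finite G] (k : Type*) [Field k]
    (ω : G → G → G → kˣ)
    (hnorm : ∀ x y z : G, x = 1 ∨ y = 1 ∨ z = 1 → ω x y z = 1)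
    (hcoc : ∀ g x y z : G,
      ω g x y * ω g (x * y) z * ω x y z = ω (g * x) y z * ω g x (y * z))
    (a b y z : G) :
    theta ω y a b * theta ω z a b * gammaCochain ω a y z *
        gammaCochain ω b (a⁻¹ * y * a) (a⁻¹ * z * a)
      = theta ω (y * z) a b * gammaCochain ω (a * b) y z := by
  have shuffle := cocycle_shuffle (fun x y z => Additive.ofMul (ω x y z))
    (fun g x y z => congrArg Additive.ofMul (hcoc g x y z))
    (a := a) (b := b) (y := y) (z := z)
    (y₁ := a⁻¹ * y * a) (y₂ := (a * b)⁻¹ * y * (a * b))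
    (z₁ := a⁻¹ * z * a) (z₂ := (a * b)⁻¹ * z * (a * b))
    (by group) (by group) (by group) (by group)
  have conj_conj (x : G) : b⁻¹ * (a⁻¹ * x * a) * b = (a * b)⁻¹ * x * (a * b) := by group
  have conj_mul (c : G) : c⁻¹ * (y * z) * c = c⁻¹ * y * c * (c⁻¹ * z * c) := by group
  simp only [theta, gammaCochain, conj_conj, conj_mul]
  exact Additive.ofMul.injective shuffle
end

section
/- Let G be a finite group, k a field, and ω : G × G × G → k× a normalized 3-cocycle. Define γ_g(x,y) = ω(x,y,g)·ω(g, g⁻¹xg, g⁻¹yg) / ω(x, g, g⁻¹yg). Then for all a, b, c, z ∈ G: γ_z(a,b)·γ_z(ab,c)·ω(z⁻¹az, z⁻¹bz, z⁻¹cz) = γ_z(b,c)·γ_z(a,bc)·ω(a,b,c). -/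
/-- Identity (27) of the paper:
`γ_z(a,b)·γ_z(ab,c)·ω(z⁻¹az, z⁻¹bz, z⁻¹cz) = γ_z(b,c)·γ_z(a,bc)·ω(a,b,c)`. -/
theorem gamma_cocycle_identity
    (G : Type*) [Group G] [Finite G] (k : Type*) [Field k]
    (ω : G → G → G → kˣ)
    (hnorm : ∀ x y z : G, x = 1 ∨ y = 1 ∨ z = 1 → ω x y z = 1)
    (hcoc : ∀ g x y z : G,
      ω g x y * ω g (x * y) z * ω x y z = ω (g * x) y z * ω g x (y * z))
    (a b c z : G) :
    gammaCochain ω z a b * gammaCochain ω z (a * b) c *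
        ω (z⁻¹ * a * z) (z⁻¹ * b * z) (z⁻¹ * c * z)
      = gammaCochain ω z b c * gammaCochain ω z a (b * c) * ω a b c := by
  have hconj (x : G) : z * (z⁻¹ * x * z) = x * z := by group
  have hconj_mul (x y : G) : z⁻¹ * (x * y) * z = (z⁻¹ * x * z) * (z⁻¹ * y * z) := by group
  have habcz := hcoc a b c z
  have habzc := hcoc a b z (z⁻¹ * c * z)
  have hazbc := hcoc a z (z⁻¹ * b * z) (z⁻¹ * c * z)
  have hzabc := hcoc z (z⁻¹ * a * z) (z⁻¹ * b * z) (z⁻¹ * c * z)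
  simp only [gammaCochain, hconj_mul]
  simp only [hconj] at habzc hazbc hzabc
  apply_fun Additive.ofMul at habcz habzc hazbc hzabc
  apply Additive.ofMul.injective
  simp only [ofMul_mul, ofMul_div] at habcz habzc hazbc hzabc ⊢
  linear_combination (norm := abel) hzabc + habzc - habcz - hazbc
end

section
/- Let G be a finite group, k a field, and ω : G × G × G → k× a normalized 3-cocycle. Define θ_g(x,y) = ω(g,x,y)·ω(x,y,(xy)⁻¹g(xy)) / ω(x, x⁻¹gx, y). Then for all g, x ∈ G: θ_g(x, x⁻¹) = θ_{x⁻¹gx}(x⁻¹, x). -/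
/-- For a normalized 3-cocycle `ω`:
`θ_g(x, x⁻¹) = θ_{x⁻¹gx}(x⁻¹, x)`. -/
theorem theta_inv_pair_identity
    (G : Type*) [Group G] [Finite G] (k : Type*) [Field k]
    (ω : G → G → G → kˣ)
    (hnorm : ∀ x y z : G, x = 1 ∨ y = 1 ∨ z = 1 → ω x y z = 1)
    (hcoc : ∀ g x y z : G,
      ω g x y * ω g (x * y) z * ω x y z = ω (g * x) y z * ω g x (y * z))
    (g x : G) :
    theta ω g x x⁻¹ = theta ω (x⁻¹ * g * x) x⁻¹ x := by
  have hgx : x * (x⁻¹ * g * x) = g * x := by group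
  have hgx' : x⁻¹ * g * x * x⁻¹ = x⁻¹ * g := by group
  have hconj : x⁻¹⁻¹ * (x⁻¹ * g * x) * x⁻¹ = g := by group
  have c₀ := hcoc g x x⁻¹ x
  have c₁ := hcoc x (x⁻¹ * g * x) x⁻¹ x
  have c₂ := hcoc x x⁻¹ g x
  have c₃ := hcoc x x⁻¹ x (x⁻¹ * g * x)
  simp only [hgx, hgx', mul_inv_cancel, inv_mul_cancel, hnorm _ _ 1 (by simp),
    hnorm _ 1 _ (by simp), hnorm 1 _ _ (by simp), mul_one, one_mul] at c₀ c₁ c₂ c₃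
  simp only [theta, hconj, mul_inv_cancel, inv_mul_cancel, inv_one, mul_one, one_mul]
  rw [div_eq_div_iff_mul_eq_mul]
  apply mul_right_cancel (b := ω x x⁻¹ x * ω x (x⁻¹ * g) x)
  calc
    _ = (ω g x x⁻¹ * ω x x⁻¹ x) * (ω x x⁻¹ g * ω x (x⁻¹ * g) x * ω x⁻¹ g x) := by
      ac_rfl
    _ = (ω x (x⁻¹ * g * x) x⁻¹ * ω x (x⁻¹ * g) x * ω (x⁻¹ * g * x) x⁻¹ x) *
        (ω x x⁻¹ x * ω x⁻¹ x (x⁻¹ * g * x)) := by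
      rw [c₀, c₁, c₂, c₃]
    _ = _ := by ac_rfl
end

section
/- Let G be a finite group, k a field, and ω : G × G × G → k× a normalized 3-cocycle. Define γ_g(x,y) = ω(x,y,g)·ω(g, g⁻¹xg, g⁻¹yg) / ω(x, g, g⁻¹yg), and write aᶻ = z⁻¹az. Then for all a, z ∈ G: γ_z(a, a⁻¹)·ω(aᶻ, (a⁻¹)ᶻ, aᶻ) = γ_z(a⁻¹, a)·ω(a, a⁻¹, a). -/
/-- For a normalized 3-cocycle `ω`, with `aᶻ = z⁻¹az`:
`γ_z(a, a⁻¹)·ω(aᶻ, (a⁻¹)ᶻ, aᶻ) = γ_z(a⁻¹, a)·ω(a, a⁻¹, a)`. -/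
theorem gamma_inv_pair_identity
    (G : Type*) [Group G] [Finite G] (k : Type*) [Field k]
    (ω : G → G → G → kˣ)
    (hnorm : ∀ x y z : G, x = 1 ∨ y = 1 ∨ z = 1 → ω x y z = 1)
    (hcoc : ∀ g x y z : G,
      ω g x y * ω g (x * y) z * ω x y z = ω (g * x) y z * ω g x (y * z))
    (a z : G) :
    gammaCochain ω z a a⁻¹ * ω (z⁻¹ * a * z) (z⁻¹ * a⁻¹ * z) (z⁻¹ * a * z)
      = gammaCochain ω z a⁻¹ a * ω a a⁻¹ a := by
  have conj_inv_mul : z⁻¹ * a⁻¹ * z * (z⁻¹ * a * z) = 1 := by group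
  have conj_mul_inv : z⁻¹ * a * z * (z⁻¹ * a⁻¹ * z) = 1 := by group
  have mul_conj : z * (z⁻¹ * a * z) = a * z := by group
  have mul_conj_inv : z * (z⁻¹ * a⁻¹ * z) = a⁻¹ * z := by group
  unfold gammaCochain
  have hzbcb := hcoc z (z⁻¹ * a * z) (z⁻¹ * a⁻¹ * z) (z⁻¹ * a * z)
  have hazcb := hcoc a z (z⁻¹ * a⁻¹ * z) (z⁻¹ * a * z)
  have haazb := hcoc a a⁻¹ z (z⁻¹ * a * z)
  have haaaz := hcoc a a⁻¹ a z
  generalize z⁻¹ * a * z = b at *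
  generalize z⁻¹ * a⁻¹ * z = c at *
  have norm_left (x y : G) : ω 1 x y = 1 := hnorm 1 x y (.inl rfl)
  have norm_mid (x y : G) : ω x 1 y = 1 := hnorm x 1 y (.inr (.inl rfl))
  have norm_right (x y : G) : ω x y 1 = 1 := hnorm x y 1 (.inr (.inr rfl))
  simp only [conj_inv_mul, conj_mul_inv, mul_conj, mul_conj_inv, mul_inv_cancel, inv_mul_cancel,
    norm_left, norm_mid, norm_right, mul_one, one_mul] at hzbcb hazcb haazb haaaz
  rw [div_mul_eq_mul_div, div_mul_eq_mul_div, div_eq_div_iff_mul_eq_mul]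
  calc ω a a⁻¹ z * ω z b c * ω b c b * ω a⁻¹ z b
      = ω a a⁻¹ z * (ω z b c * ω b c b) * ω a⁻¹ z b := by ac_rfl
    _ = ω a a⁻¹ z * (ω a z c * ω a (a⁻¹ * z) b * ω z c b) * ω a⁻¹ z b := by rw [hzbcb, hazcb]
    _ = ω a a⁻¹ z * ω a (a⁻¹ * z) b * ω a⁻¹ z b * (ω a z c * ω z c b) := by ac_rfl
    _ = ω a a⁻¹ a * ω a⁻¹ a z * (ω a z c * ω z c b) := by rw [haazb, haaaz]
    _ = ω a⁻¹ a z * ω z c b * ω a a⁻¹ a * ω a z c := by ac_rfl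
end

section
/- Let G be a finite group, k a field, and ω : G × G × G → k× a normalized 3-cocycle. Define θ_g(x,y) = ω(g,x,y)·ω(x,y,(xy)⁻¹g(xy)) / ω(x, x⁻¹gx, y) and γ_g(x,y) = ω(x,y,g)·ω(g, g⁻¹xg, g⁻¹yg) / ω(x, g, g⁻¹yg), and write aˣ = x⁻¹ax. Then for all g, x ∈ G: θ_{g⁻¹}(x, x⁻¹)·γ_x(g, g⁻¹)·θ_{gˣ}(x⁻¹, x)·γ_{x⁻¹}((g⁻¹)ˣ, gˣ) = ω(g, g⁻¹, g) / ω(gˣ, (g⁻¹)ˣ, gˣ). -/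
/-- The scalar identity underlying Lemma 9.1 of the paper, with
`aˣ = x⁻¹ax`:
`θ_{g⁻¹}(x,x⁻¹)·γ_x(g,g⁻¹)·θ_{gˣ}(x⁻¹,x)·γ_{x⁻¹}((g⁻¹)ˣ, gˣ) = ω(g,g⁻¹,g)/ω(gˣ,(g⁻¹)ˣ,gˣ)`. -/
theorem antipode_sq_scalar_identity
    (G : Type*) [Group G] [Finite G] (k : Type*) [Field k]
    (ω : G → G → G → kˣ)
    (hnorm : ∀ x y z : G, x = 1 ∨ y = 1 ∨ z = 1 → ω x y z = 1)
    (hcoc : ∀ g x y z : G,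
      ω g x y * ω g (x * y) z * ω x y z = ω (g * x) y z * ω g x (y * z))
    (g x : G) :
    theta ω g⁻¹ x x⁻¹ * gammaCochain ω x g g⁻¹ *
        theta ω (x⁻¹ * g * x) x⁻¹ x *
        gammaCochain ω x⁻¹ (x⁻¹ * g⁻¹ * x) (x⁻¹ * g * x)
      = ω g g⁻¹ g / ω (x⁻¹ * g * x) (x⁻¹ * g⁻¹ * x) (x⁻¹ * g * x) := by
  have hone_left (y z : G) : ω 1 y z = 1 := hnorm 1 y z (by simp)
  have hone_mid (y z : G) : ω y 1 z = 1 := hnorm y 1 z (by simp)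
  have hone_right (y z : G) : ω y z 1 = 1 := hnorm y z 1 (by simp)
  -- Written additively, the identity is a signed sum of instances of the cocycle identity.
  have coc (a b c d : G) :
      Additive.ofMul (ω a b c) + Additive.ofMul (ω a (b * c) d) + Additive.ofMul (ω b c d) =
        Additive.ofMul (ω (a * b) c d) + Additive.ofMul (ω a b (c * d)) :=
    congrArg Additive.ofMul (hcoc a b c d)
  apply Additive.ofMul.injective
  linear_combination (norm := skip)
    coc x⁻¹ (g⁻¹ * x) x⁻¹ x
    + coc (x⁻¹ * g⁻¹ * x) x⁻¹ x (x⁻¹ * g)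
    + coc g g⁻¹ x (x⁻¹ * g)
    + coc x (x⁻¹ * g * x) (x⁻¹ * g⁻¹ * x) (x⁻¹ * g * x)
    + coc (g * x) (x⁻¹ * g⁻¹ * x) (x⁻¹ * g * x) x⁻¹
    + coc (g * x) x⁻¹ x x⁻¹
    + coc g x x⁻¹ (g⁻¹ * x)
    + coc (g * x) x⁻¹ (g⁻¹ * x) (x⁻¹ * g)
    + coc x (x⁻¹ * g * x) x⁻¹ x
    - coc x x⁻¹ (g⁻¹ * x) x⁻¹
    - coc (g⁻¹ * x) x⁻¹ x x⁻¹
    - coc x⁻¹ g⁻¹ x (x⁻¹ * g)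
    - coc x⁻¹ x (x⁻¹ * g) x
  simp only [theta, gammaCochain, mul_assoc, inv_inv, inv_mul_cancel, mul_inv_cancel,
    inv_mul_cancel_left, mul_inv_cancel_left, mul_one, one_mul, inv_one, hone_left, hone_mid,
    hone_right, ofMul_mul, ofMul_div, ofMul_one, add_zero, zero_add]
  abel
end
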